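/- Let X be a Polish space with its Borel σ-algebra, let P and Q be Borel probability measures on X with 0 < D(P‖Q) < ∞, and let α ∈ (0,1). For each n, let β_n = inf { Q^⊗n(A) : A ⊆ X^n measurable and P^⊗n(X^n \ A) ≤ α } be the minimal type-II error probability over all level-α acceptance regions for n i.i.d. observations. Then lim_{n→∞} −(1/n) log β_n = D(P‖Q). -/

import Mathlib

open MeasureTheory Filter Topology ENNReal
open scoped Classical

noncomputable section
/-- The Kullback-Leibler divergence `D(P‖Q) ∈ [0,∞]`: it equals `∫ log (dP/dQ) dP` when
`P ≪ Q` (and the integral is well defined), and `+∞` otherwise. -/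
def klDiv {X : Type*} [MeasurableSpace X] (P Q : Measure X) : ℝ≥0∞ :=
  if P ≪ Q ∧ Integrable (llr P Q) P then ENNReal.ofReal (∫ x, llr P Q x ∂P) else ⊤
/-- The exponential decay rate `-(1/n) log p` of a probability `p`, valued in `EReal`
(with `-(1/n) log 0 = ⊤`). -/
def expRate (n : ℕ) (p : ℝ≥0∞) : EReal := -((((n : ℝ)⁻¹ : ℝ) : EReal) * ENNReal.log p)

/-- The product of measures with densities has the product of the densities as its density. -/
theorem pi_withDensity {ι X : Type*} [Fintype ι] [MeasurableSpace X] {Q : Measure X}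
    [IsProbabilityMeasure Q] {f : X → ℝ≥0∞} (hf : Measurable f)
    [IsProbabilityMeasure (Q.withDensity f)] :
    Measure.pi (fun _ : ι => Q.withDensity f) =
      (Measure.pi fun _ : ι => Q).withDensity fun x => ∏ i, f (x i) := by
  refine Measure.pi_eq fun s hs => ?_
  have hind : ∀ x : ι → X, (Set.univ.pi s).indicator (fun x => ∏ i, f (x i)) x =
      ∏ i, (s i).indicator f (x i) := by
    intro x
    by_cases hx : x ∈ Set.univ.pi s
    · rw [Set.indicator_of_mem hx]
      exact Finset.prod_congr rfl fun i _ => (Set.indicator_of_mem (hx i trivial) f).symm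
    · rw [Set.indicator_of_notMem hx]
      obtain ⟨i, hi⟩ : ∃ i, x i ∉ s i := by simpa [Set.mem_pi] using hx
      exact (Finset.prod_eq_zero (Finset.mem_univ i) (Set.indicator_of_notMem hi f)).symm
  have hm : ∀ i, Measurable ((s i).indicator f) := fun i => hf.indicator (hs i)
  rw [withDensity_apply _ (MeasurableSet.univ_pi hs), ← lintegral_indicator (.univ_pi hs)]
  simp_rw [hind]
  rw [ProbabilityTheory.lintegral_prod_eq_prod_lintegral_of_indepFun Finset.univ
    (fun i (x : ι → X) => (s i).indicator f (x i))
    (ProbabilityTheory.iIndepFun_pi fun i => (hm i).aemeasurable)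
    (fun i => (hm i).comp (measurable_pi_apply i))]
  refine Finset.prod_congr rfl fun i _ => ?_
  rw [(measurePreserving_eval (fun _ : ι => Q) i).lintegral_comp (hm i),
    lintegral_indicator (hs i), withDensity_apply _ (hs i)]

/-- The **weak law of large numbers** on finite product spaces. -/
theorem tendsto_pi_setOf_le_abs_average_sub {X : Type*} [MeasurableSpace X] (P : Measure X)
    [IsProbabilityMeasure P] {g : X → ℝ} (hg : Measurable g) (hint : Integrable g P)
    {δ : ℝ} (hδ : 0 < δ) :
    Tendsto (fun n : ℕ => Measure.pi (fun _ : Fin n => P)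
      {x | δ ≤ |(∑ i, g (x i)) / n - ∫ y, g y ∂P|}) atTop (𝓝 0) := by
  set μ : Measure (ℕ → X) := Measure.infinitePi fun _ => P with hμ
  have heval : ∀ i, MeasurePreserving (fun ω : ℕ → X => ω i) μ P := fun i =>
    measurePreserving_eval_infinitePi (fun _ => P) i
  have hslln : ∀ᵐ ω ∂μ, Tendsto (fun n : ℕ => (∑ i ∈ Finset.range n, g (ω i)) / n) atTop
      (𝓝 (∫ y, g y ∂P)) := by
    have := ProbabilityTheory.strong_law_ae_real (μ := μ) (fun i ω => g (ω i))
      ((heval 0).integrable_comp_of_integrable hint)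
      (fun i j hij => (ProbabilityTheory.iIndepFun_infinitePi fun _ => hg).indepFun hij)
      (fun i => ProbabilityTheory.IdentDistrib.comp (u := g)
        ⟨(heval i).aemeasurable, (heval 0).aemeasurable,
          (heval i).map_eq.trans (heval 0).map_eq.symm⟩ hg)
    have hE : ∫ ω, g (ω 0) ∂μ = ∫ y, g y ∂P := by
      rw [← (heval 0).map_eq, integral_map (heval 0).aemeasurable hg.aestronglyMeasurable]
    simpa only [hE] using this
  have hmeas := tendstoInMeasure_of_tendsto_ae (fun n => by
    refine Measurable.aestronglyMeasurable ?_
    fun_prop) hslln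
  rw [tendstoInMeasure_iff_dist] at hmeas
  refine (hmeas δ hδ).congr fun n => ?_
  have hpres : μ.map (fun ω (i : Fin n) => ω i) = Measure.pi fun _ : Fin n => P := by
    have hind : ProbabilityTheory.iIndepFun (fun (i : Fin n) (ω : ℕ → X) => ω i) μ :=
      (ProbabilityTheory.iIndepFun_infinitePi (X := fun _ x => x)
        fun _ => measurable_id).precomp Fin.val_injective
    rw [(ProbabilityTheory.iIndepFun_iff_map_fun_eq_pi_map
      fun i : Fin n => (heval i).aemeasurable).1 hind]
    congr with i : 1
    exact (heval i).map_eq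
  rw [← hpres, Measure.map_apply (by fun_prop) (measurableSet_le (by fun_prop) (by fun_prop))]
  simp [Real.dist_eq, Finset.sum_range]

/-- The asymptotic equipartition property: under `P ^ n`, the likelihood ratio is eventually
within `exp (n (D ± δ))` with probability close to one. -/
theorem tendsto_pi_compl_setOf_prod_rnDeriv_mem_Icc {X : Type*} [MeasurableSpace X]
    {P Q : Measure X} [IsProbabilityMeasure P] [IsProbabilityMeasure Q] (hPQ : P ≪ Q)
    (hint : Integrable (llr P Q) P) {δ : ℝ} (hδ : 0 < δ) :
    Tendsto (fun n : ℕ => Measure.pi (fun _ : Fin n => P)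
      {x | ∏ i, P.rnDeriv Q (x i) ∈
        Set.Icc (ENNReal.ofReal (Real.exp (n * (∫ y, llr P Q y ∂P - δ))))
          (ENNReal.ofReal (Real.exp (n * (∫ y, llr P Q y ∂P + δ))))}ᶜ) atTop (𝓝 0) := by
  refine tendsto_of_tendsto_of_tendsto_of_le_of_le' tendsto_const_nhds
    (tendsto_pi_setOf_le_abs_average_sub P (measurable_llr P Q) hint hδ)
    (.of_forall fun _ => zero_le) ?_
  filter_upwards [eventually_gt_atTop 0] with n hn
  have hae : ∀ᵐ x ∂Measure.pi (fun _ : Fin n => P), ∀ i,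
      P.rnDeriv Q (x i) = ENNReal.ofReal (Real.exp (llr P Q (x i))) := by
    refine ae_all_iff.2 fun i =>
      (measurePreserving_eval (fun _ : Fin n => P) i).quasiMeasurePreserving.ae
        (p := fun y => P.rnDeriv Q y = ENNReal.ofReal (Real.exp (llr P Q y))) ?_
    filter_upwards [exp_llr_of_ac P Q hPQ, hPQ.ae_le (Measure.rnDeriv_lt_top P Q)] with y hy hy'
    rw [hy, ENNReal.ofReal_toReal hy'.ne]
  refine measure_mono_ae ?_
  filter_upwards [hae] with x hx hmem
  change δ ≤ |(∑ i, llr P Q (x i)) / n - ∫ y, llr P Q y ∂P|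
  by_contra! hlt
  refine hmem ?_
  change ∏ i, P.rnDeriv Q (x i) ∈ Set.Icc _ _
  simp only [hx]
  have hn' : (0 : ℝ) < n := by exact_mod_cast hn
  rw [← ENNReal.ofReal_prod_of_nonneg fun i _ => (Real.exp_pos _).le, ← Real.exp_sum]
  rw [abs_lt, lt_sub_iff_add_lt, sub_lt_iff_lt_add, lt_div_iff₀ hn', div_lt_iff₀ hn'] at hlt
  constructor <;> refine ENNReal.ofReal_le_ofReal (Real.exp_le_exp.2 ?_) <;> linarith

theorem expRate_antitone (n : ℕ) : Antitone (expRate n) := fun _ _ h =>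
  EReal.neg_le_neg_iff.2 <| mul_le_mul_of_nonneg_left (ENNReal.log_le_log h)
    (EReal.coe_nonneg.2 (by positivity))

theorem expRate_ofReal_exp {n : ℕ} (hn : n ≠ 0) (t : ℝ) :
    expRate n (ENNReal.ofReal (Real.exp (-(n * t)))) = t := by
  have hn' : (n : ℝ) ≠ 0 := by exact_mod_cast hn
  rw [expRate, ENNReal.log_ofReal_of_pos (Real.exp_pos _), Real.log_exp, ← EReal.coe_mul,
    ← EReal.coe_neg]
  congr 1
  field_simp

/-- The minimal type-II error probability over the level-`α` acceptance regions for `n`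
observations. -/
def minTypeTwoError {X : Type*} [MeasurableSpace X] (P Q : Measure X) (α : ℝ) (n : ℕ) : ℝ≥0∞ :=
  ⨅ (A : Set (Fin n → X)) (_ : MeasurableSet A)
    (_ : Measure.pi (fun _ : Fin n => P) Aᶜ ≤ ENNReal.ofReal α),
  Measure.pi (fun _ : Fin n => Q) A

theorem measurable_prod_rnDeriv {X : Type*} [MeasurableSpace X] {P Q : Measure X} (n : ℕ) :
    Measurable fun x : Fin n → X => ∏ i, P.rnDeriv Q (x i) :=
  Finset.measurable_prod _ fun i _ =>
    (Measure.measurable_rnDeriv P Q).comp (measurable_pi_apply i)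

section Bounds

variable {X : Type*} [MeasurableSpace X] {P Q : Measure X} [IsProbabilityMeasure P]
  [IsProbabilityMeasure Q] {α δ : ℝ}

theorem pi_eq_withDensity_prod_rnDeriv (hPQ : P ≪ Q) (n : ℕ) :
    Measure.pi (fun _ : Fin n => P) =
      (Measure.pi fun _ : Fin n => Q).withDensity fun x => ∏ i, P.rnDeriv Q (x i) := by
  have h := Measure.withDensity_rnDeriv_eq P Q hPQ
  have : IsProbabilityMeasure (Q.withDensity (P.rnDeriv Q)) := by rw [h]; infer_instance
  rw [← pi_withDensity (Measure.measurable_rnDeriv P Q), h]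

theorem eventually_minTypeTwoError_le (hPQ : P ≪ Q) (hint : Integrable (llr P Q) P)
    (hα : 0 < α) (hδ : 0 < δ) :
    ∀ᶠ n : ℕ in atTop, minTypeTwoError P Q α n ≤
      ENNReal.ofReal (Real.exp (-(n * (∫ y, llr P Q y ∂P - δ)))) := by
  filter_upwards [(tendsto_pi_compl_setOf_prod_rnDeriv_mem_Icc hPQ hint hδ).eventually_le_const
    (ENNReal.ofReal_pos.2 hα)] with n hn
  refine (iInf₂_le_of_le _ (measurable_prod_rnDeriv n measurableSet_Icc)
    (iInf_le_of_le hn (measure_mono fun x hx => hx.1))).trans ?_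
  have hmarkov := mul_meas_ge_le_lintegral (μ := Measure.pi fun _ : Fin n => Q)
    (measurable_prod_rnDeriv (P := P) (Q := Q) n)
    (ENNReal.ofReal (Real.exp (n * (∫ y, llr P Q y ∂P - δ))))
  rw [← setLIntegral_univ, ← withDensity_apply _ .univ, ← pi_eq_withDensity_prod_rnDeriv hPQ,
    measure_univ, mul_comm] at hmarkov
  rw [Real.exp_neg, ENNReal.ofReal_inv_of_pos (Real.exp_pos _), ← one_div]
  exact ENNReal.le_div_iff_mul_le (.inl (by positivity)) (.inl ofReal_ne_top) |>.2 hmarkov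

theorem eventually_le_minTypeTwoError (hPQ : P ≪ Q) (hint : Integrable (llr P Q) P)
    (hα0 : 0 ≤ α) (hα1 : α < 1) (hδ : 0 < δ) :
    ∀ᶠ n : ℕ in atTop, ENNReal.ofReal (Real.exp (-(n * (∫ y, llr P Q y ∂P + δ)))) ≤
      minTypeTwoError P Q α n := by
  have hc : 0 < (1 - α) / 2 := by linarith
  have hexp : Tendsto (fun n : ℕ => Real.exp (-(n * (δ / 2)))) atTop (𝓝 0) :=
    Real.tendsto_exp_neg_atTop_nhds_zero.comp
      (tendsto_natCast_atTop_atTop.atTop_mul_const (half_pos hδ))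
  filter_upwards [(tendsto_pi_compl_setOf_prod_rnDeriv_mem_Icc hPQ hint
    (half_pos hδ)).eventually_le_const (ENNReal.ofReal_pos.2 hc), hexp.eventually_le_const hc]
    with n hn hexpn
  refine le_iInf₂ fun A hA => le_iInf fun hAα => ?_
  set T : Set (Fin n → X) := {x | ∏ i, P.rnDeriv Q (x i) ∈
    Set.Icc (ENNReal.ofReal (Real.exp (n * (∫ y, llr P Q y ∂P - δ / 2))))
      (ENNReal.ofReal (Real.exp (n * (∫ y, llr P Q y ∂P + δ / 2))))}
  have hT : MeasurableSet T := measurable_prod_rnDeriv n measurableSet_Icc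
  have hlower : ENNReal.ofReal ((1 - α) / 2) ≤ Measure.pi (fun _ : Fin n => P) (A ∩ T) := by
    have h1 : 1 ≤ Measure.pi (fun _ : Fin n => P) (A ∩ T) +
        (ENNReal.ofReal α + ENNReal.ofReal ((1 - α) / 2)) := calc
      1 = Measure.pi (fun _ : Fin n => P) (A ∩ T) +
          Measure.pi (fun _ : Fin n => P) (A ∩ T)ᶜ :=
        (prob_add_prob_compl (hA.inter hT)).symm
      _ ≤ _ := by
        rw [Set.compl_inter]
        gcongr
        exact (measure_union_le _ _).trans (add_le_add hAα hn)
    rw [← ENNReal.ofReal_add hα0 hc.le] at h1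
    refine (ENNReal.add_le_add_iff_right (ofReal_ne_top (r := α + (1 - α) / 2))).1
      (le_trans (le_of_eq ?_) h1)
    rw [← ENNReal.ofReal_add hc.le (by linarith), ← ENNReal.ofReal_one]
    congr 1
    ring
  have hupper : Measure.pi (fun _ : Fin n => P) (A ∩ T) ≤
      ENNReal.ofReal (Real.exp (n * (∫ y, llr P Q y ∂P + δ / 2))) *
        Measure.pi (fun _ : Fin n => Q) A := by
    rw [pi_eq_withDensity_prod_rnDeriv hPQ, withDensity_apply _ (hA.inter hT)]
    calc _ ≤ ∫⁻ _ in A ∩ T, ENNReal.ofReal (Real.exp (n * (∫ y, llr P Q y ∂P + δ / 2)))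
          ∂Measure.pi (fun _ : Fin n => Q) :=
        setLIntegral_mono measurable_const fun x hx => hx.2.2
      _ ≤ _ := by
        rw [setLIntegral_const]
        gcongr
        exact Set.inter_subset_left
  have hsplit : Real.exp (-(n * (∫ y, llr P Q y ∂P + δ))) =
      Real.exp (-(n * (δ / 2))) / Real.exp (n * (∫ y, llr P Q y ∂P + δ / 2)) := by
    rw [← Real.exp_sub]
    congr 1
    ring
  rw [hsplit, ENNReal.ofReal_div_of_pos (Real.exp_pos _)]
  exact ENNReal.div_le_of_le_mul'
    ((ENNReal.ofReal_le_ofReal hexpn).trans (hlower.trans hupper))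

end Bounds

/-- **Chernoff-Stein lemma.** For simple hypothesis testing between `P` and `Q` on a Polish
space with `0 < D(P‖Q) < ∞` and level constraint `α ∈ (0,1)`, the minimal type-II error
probability `β_n` over all level-`α` acceptance regions satisfies
`lim_n -(1/n) log β_n = D(P‖Q)`. -/
theorem chernoff_stein_lemma {X : Type*} [MeasurableSpace X] [TopologicalSpace X]
    [PolishSpace X] [BorelSpace X]
    (P Q : Measure X) [IsProbabilityMeasure P] [IsProbabilityMeasure Q]
    (hD0 : 0 < klDiv P Q) (hD1 : klDiv P Q < ⊤)
    {α : ℝ} (hα0 : 0 < α) (hα1 : α < 1) :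
    Tendsto
      (fun n : ℕ => expRate n
        (⨅ (A : Set (Fin n → X)) (_ : MeasurableSet A)
            (_ : Measure.pi (fun _ : Fin n => P) Aᶜ ≤ ENNReal.ofReal α),
          Measure.pi (fun _ : Fin n => Q) A))
      atTop (𝓝 ((klDiv P Q : ℝ≥0∞) : EReal)) := by
  have hac : P ≪ Q ∧ Integrable (llr P Q) P := by
    by_contra h
    simp [klDiv, h] at hD1
  obtain ⟨hPQ, hint⟩ := hac
  have hD : klDiv P Q = ENNReal.ofReal (∫ x, llr P Q x ∂P) := if_pos ⟨hPQ, hint⟩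
  rw [hD] at hD0 ⊢
  rw [EReal.coe_ennreal_ofReal, max_eq_left (ENNReal.ofReal_pos.1 hD0).le]
  change Tendsto (fun n : ℕ => expRate n (minTypeTwoError P Q α n)) atTop _
  refine tendsto_order.2 ⟨fun a ha => ?_, fun b hb => ?_⟩
  · obtain ⟨r, har, hrD⟩ := EReal.lt_iff_exists_real_btwn.1 ha
    filter_upwards [eventually_gt_atTop 0, eventually_minTypeTwoError_le hPQ hint hα0
      (sub_pos.2 (EReal.coe_lt_coe_iff.1 hrD))] with n hn h
    rw [_root_.sub_sub_cancel] at h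
    exact har.trans_le ((expRate_ofReal_exp hn.ne' r).ge.trans (expRate_antitone n h))
  · obtain ⟨r, hDr, hrb⟩ := EReal.lt_iff_exists_real_btwn.1 hb
    filter_upwards [eventually_gt_atTop 0, eventually_le_minTypeTwoError hPQ hint hα0.le hα1
      (sub_pos.2 (EReal.coe_lt_coe_iff.1 hDr))] with n hn h
    rw [add_sub_cancel] at h
    exact ((expRate_antitone n h).trans (expRate_ofReal_exp hn.ne' r).le).trans_lt hrb
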